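/- arXiv:1609.08914 — 2 statements merged into one kernel-verified Lean document; each statement's English description precedes it below -/
import Mathlib

section
/- Let a, b : ℤ → ℝ, neither identically zero, and suppose the Hurwitz-type matrix H(a,b) is totally nonnegative. Then for all k ∈ ℤ and all integers r ≥ 1: (i) if a_k = 0 and a_{k−1} ≠ 0 then b_{k+r} = 0; (ii) if a_k = 0 and a_{k+1} ≠ 0 then b_{k−r+1} = 0; (iii) if b_k = 0 and b_{k−1} ≠ 0 then a_{k+r−1} = 0; (iv) if b_k = 0 and b_{k+1} ≠ 0 then a_{k−r} = 0. In addition, for every k ∈ ℤ: if a_{k−1} ≠ 0 and a_k ≠ 0 then b_k ≠ 0, and if b_k ≠ 0 and b_{k+1} ≠ 0 then a_k ≠ 0. -/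
/-- A doubly infinite real matrix is totally nonnegative if all its minors
(with rows and columns selected in increasing order) are nonnegative. -/
def TotallyNonneg (M : ℤ → ℤ → ℝ) : Prop :=
  ∀ (k : ℕ) (i j : Fin k → ℤ), StrictMono i → StrictMono j →
    0 ≤ (Matrix.of fun r s => M (i r) (j s)).det

/-- The doubly infinite Hurwitz-type matrix of two sequences `a b : ℤ → ℝ`:
row `2m` is `j ↦ a (j - m)` and row `2m+1` is `j ↦ b (j - m)`. -/
def hurwitz (a b : ℤ → ℝ) : ℤ → ℤ → ℝ :=
  fun i j => if 2 ∣ i then a (j - i / 2) else b (j - (i - 1) / 2)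

theorem hurwitz_even (a b : ℤ → ℝ) (m j : ℤ) : hurwitz a b (2 * m) j = a (j - m) := by
  simp [hurwitz]

theorem hurwitz_odd (a b : ℤ → ℝ) (m j : ℤ) : hurwitz a b (2 * m + 1) j = b (j - m) := by
  have h : ¬ (2 : ℤ) ∣ 2 * m + 1 := by omega
  simp [hurwitz, h]

theorem TotallyNonneg.entry_nonneg {M : ℤ → ℤ → ℝ} (h : TotallyNonneg M) (i j : ℤ) :
    0 ≤ M i j := by
  simpa using h 1 (fun _ => i) (fun _ => j) (Subsingleton.strictMono _) (Subsingleton.strictMono _)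

theorem TotallyNonneg.mul_le_mul {M : ℤ → ℤ → ℝ} (h : TotallyNonneg M) {i i' j j' : ℤ}
    (hi : i < i') (hj : j < j') : M i j' * M i' j ≤ M i j * M i' j' := by
  have := h 2 ![i, i'] ![j, j'] (by simpa [Fin.strictMono_iff_lt_succ] using hi)
    (by simpa [Fin.strictMono_iff_lt_succ] using hj)
  simpa [Matrix.det_fin_two] using this

section Hurwitz

variable {a b : ℤ → ℝ}

theorem TotallyNonneg.left_nonneg (h : TotallyNonneg (hurwitz a b)) (n : ℤ) : 0 ≤ a n := by
  simpa only [hurwitz_even, sub_zero] using h.entry_nonneg (2 * 0) n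

theorem TotallyNonneg.right_nonneg (h : TotallyNonneg (hurwitz a b)) (n : ℤ) : 0 ≤ b n := by
  simpa only [hurwitz_odd, sub_zero] using h.entry_nonneg (2 * 0 + 1) n

theorem TotallyNonneg.left_mul_right_le (h : TotallyNonneg (hurwitz a b)) {p q d : ℤ}
    (hpq : p < q) (hd : 0 ≤ d) : a q * b (p - d) ≤ a p * b (q - d) := by
  have := h.mul_le_mul (i := 2 * 0) (i' := 2 * d + 1) (by omega) hpq
  simpa only [hurwitz_even, hurwitz_odd, sub_zero] using this

theorem TotallyNonneg.right_mul_left_le (h : TotallyNonneg (hurwitz a b)) {p q d : ℤ}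
    (hpq : p < q) (hd : 1 ≤ d) : b q * a (p - d) ≤ b p * a (q - d) := by
  have := h.mul_le_mul (i := 2 * 0 + 1) (i' := 2 * d) (by omega) hpq
  simpa only [hurwitz_even, hurwitz_odd, sub_zero] using this

/-- If `a` vanishes at `p` and not at a later index `q`, then `b` vanishes up to `p`. -/
theorem TotallyNonneg.right_eq_zero_of_le (h : TotallyNonneg (hurwitz a b)) {p q n : ℤ}
    (hpq : p < q) (hp : a p = 0) (hq : a q ≠ 0) (hn : n ≤ p) : b n = 0 := by
  have := h.left_mul_right_le hpq (sub_nonneg.2 hn)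
  rw [hp, zero_mul, sub_sub_cancel] at this
  exact (nonpos_of_mul_nonpos_right this ((h.left_nonneg q).lt_of_ne' hq)).antisymm
    (h.right_nonneg n)

/-- If `a` vanishes at `q` and not at an earlier index `p`, then `b` vanishes after `q`. -/
theorem TotallyNonneg.right_eq_zero_of_lt (h : TotallyNonneg (hurwitz a b)) {p q n : ℤ}
    (hpq : p < q) (hq : a q = 0) (hp : a p ≠ 0) (hn : q < n) : b n = 0 := by
  have := h.right_mul_left_le (p := p + (n - q)) (q := n) (d := n - q) (by omega) (by omega)
  rw [sub_sub_cancel, hq, mul_zero, add_sub_cancel_right] at this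
  exact (nonpos_of_mul_nonpos_left this ((h.left_nonneg p).lt_of_ne' hp)).antisymm
    (h.right_nonneg n)

/-- If `b` vanishes at `p` and not at a later index `q`, then `a` vanishes before `p`. -/
theorem TotallyNonneg.left_eq_zero_of_lt (h : TotallyNonneg (hurwitz a b)) {p q n : ℤ}
    (hpq : p < q) (hp : b p = 0) (hq : b q ≠ 0) (hn : n < p) : a n = 0 := by
  have := h.right_mul_left_le (d := p - n) hpq (by omega)
  rw [hp, zero_mul, sub_sub_cancel] at this
  exact (nonpos_of_mul_nonpos_right this ((h.right_nonneg q).lt_of_ne' hq)).antisymm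
    (h.left_nonneg n)

/-- If `b` vanishes at `q` and not at an earlier index `p`, then `a` vanishes from `q` on. -/
theorem TotallyNonneg.left_eq_zero_of_le (h : TotallyNonneg (hurwitz a b)) {p q n : ℤ}
    (hpq : p < q) (hq : b q = 0) (hp : b p ≠ 0) (hn : q ≤ n) : a n = 0 := by
  have := h.left_mul_right_le (p := p + (n - q)) (q := n) (d := n - q) (by omega) (by omega)
  rw [sub_sub_cancel, hq, mul_zero, add_sub_cancel_right] at this
  exact (nonpos_of_mul_nonpos_left this ((h.right_nonneg p).lt_of_ne' hp)).antisymm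
    (h.left_nonneg n)

end Hurwitz

theorem stmt2 (a b : ℤ → ℝ) (ha : ∃ n, a n ≠ 0) (hb : ∃ n, b n ≠ 0)
    (h : TotallyNonneg (hurwitz a b)) :
    (∀ k r : ℤ, 1 ≤ r → a k = 0 → a (k - 1) ≠ 0 → b (k + r) = 0) ∧
    (∀ k r : ℤ, 1 ≤ r → a k = 0 → a (k + 1) ≠ 0 → b (k - r + 1) = 0) ∧
    (∀ k r : ℤ, 1 ≤ r → b k = 0 → b (k - 1) ≠ 0 → a (k + r - 1) = 0) ∧
    (∀ k r : ℤ, 1 ≤ r → b k = 0 → b (k + 1) ≠ 0 → a (k - r) = 0) ∧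
    (∀ k : ℤ, a (k - 1) ≠ 0 → a k ≠ 0 → b k ≠ 0) ∧
    (∀ k : ℤ, b k ≠ 0 → b (k + 1) ≠ 0 → a k ≠ 0) := by
  refine ⟨fun k r hr h0 h1 => h.right_eq_zero_of_lt (by omega) h0 h1 (by omega),
    fun k r hr h0 h1 => h.right_eq_zero_of_le (by omega) h0 h1 (by omega),
    fun k r hr h0 h1 => h.left_eq_zero_of_le (by omega) h0 h1 (by omega),
    fun k r hr h0 h1 => h.left_eq_zero_of_lt (by omega) h0 h1 (by omega),
    fun k h1 h2 h0 => ?_, fun k h1 h2 h0 => ?_⟩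
  · obtain ⟨n, hn⟩ := hb
    rcases lt_trichotomy n k with hlt | rfl | hlt
    · exact h2 (h.left_eq_zero_of_le hlt h0 hn le_rfl)
    · exact hn h0
    · exact h1 (h.left_eq_zero_of_lt hlt h0 hn (by omega))
  · obtain ⟨n, hn⟩ := ha
    rcases lt_trichotomy n k with hlt | rfl | hlt
    · exact h2 (h.right_eq_zero_of_lt hlt h0 hn (by omega))
    · exact hn h0
    · exact h1 (h.right_eq_zero_of_le hlt h0 hn le_rfl)
end

section
/- Let F be a function of Form (I), or of Form (II) with C > 0. Then the function G(z) = z / F(z) is an S-function: G is holomorphic on ℂ ∖ (−∞,0] away from the (negative real) zeros of F, satisfies Im z · Im G(z) ≥ 0 wherever it is defined on ℂ ∖ (−∞,0], and G(x) ≥ 0 for every real x > 0. -/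
open Complex

/-- The slit plane `ℂ ∖ (−∞, 0]`. -/
def SDom : Set ℂ := {z : ℂ | ¬ (z.im = 0 ∧ z.re ≤ 0)}

/-- `F` is an `𝒮`-function: holomorphic on `ℂ ∖ (−∞,0]`, with
`Im z · Im F(z) ≥ 0` there, and `F(x) ≥ 0` (real) for real `x > 0`. -/
def IsSFun (F : ℂ → ℂ) : Prop :=
  DifferentiableOn ℂ F SDom ∧
  (∀ z ∈ SDom, 0 ≤ z.im * (F z).im) ∧
  (∀ x : ℝ, 0 < x → (F (x : ℂ)).im = 0 ∧ 0 ≤ (F (x : ℂ)).re)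

/-- Index type for a family which is finite (of cardinality `N`) or countably
infinite (`N = ⊤`). -/
def Idx (N : ℕ∞) : Type := {ν : ℕ // (ν : ℕ∞) < N}

/-- `F` agrees on the slit plane with the function of Form (I) with data
`C, Np, Nm, αp, βp, αm, βm`: the interlacing chain
`0 < ⋯ < 1/α⁻₂ < 1/β⁻₁ < 1/α⁻₁ < β⁺₁ < α⁺₁ < β⁺₂ < α⁺₂ < ⋯` holds among the
present indices, reciprocals are summable, and
`F z = C · ∏ (1 + z/β⁺ν)/(1 + z/α⁺ν) · ∏ (1 + z⁻¹/β⁻ν)/(1 + z⁻¹/α⁻ν)`. -/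
def FormIEq (F : ℂ → ℂ) (C : ℝ) (Np Nm : ℕ∞) (αp βp αm βm : ℕ → ℝ) : Prop :=
  0 < C ∧
  (∀ ν : ℕ, (ν : ℕ∞) < Np → 0 < βp ν ∧ βp ν < αp ν) ∧
  (∀ ν : ℕ, ((ν : ℕ∞) + 1) < Np → αp ν < βp (ν + 1)) ∧
  (∀ ν : ℕ, (ν : ℕ∞) < Nm → 0 < βm ν ∧ 0 < αm ν ∧ (βm ν)⁻¹ < (αm ν)⁻¹) ∧
  (∀ ν : ℕ, ((ν : ℕ∞) + 1) < Nm → (αm (ν + 1))⁻¹ < (βm ν)⁻¹) ∧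
  (0 < Np → 0 < Nm → (αm 0)⁻¹ < βp 0) ∧
  Summable (fun ν : Idx Np => (αp ν.1)⁻¹ + (βp ν.1)⁻¹) ∧
  Summable (fun ν : Idx Nm => (αm ν.1)⁻¹ + (βm ν.1)⁻¹) ∧
  ∀ z ∈ SDom,
    Multipliable (fun ν : Idx Np => (1 + z / (βp ν.1 : ℂ)) / (1 + z / (αp ν.1 : ℂ))) ∧
    Multipliable (fun ν : Idx Nm => (1 + z⁻¹ / (βm ν.1 : ℂ)) / (1 + z⁻¹ / (αm ν.1 : ℂ))) ∧
    F z = (C : ℂ) * (∏' ν : Idx Np, (1 + z / (βp ν.1 : ℂ)) / (1 + z / (αp ν.1 : ℂ))) *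
            (∏' ν : Idx Nm, (1 + z⁻¹ / (βm ν.1 : ℂ)) / (1 + z⁻¹ / (αm ν.1 : ℂ)))

/-- `F` is of Form (I). -/
def IsFormI (F : ℂ → ℂ) : Prop :=
  ∃ C Np Nm αp βp αm βm, FormIEq F C Np Nm αp βp αm βm

/-- `F` agrees on the slit plane with the function of Form (II) with data
`C, β₀, α₀, N, β, α`: we have `0 ≤ β₀ < α₀ < β₁ < α₁ < ⋯` among the present
indices, reciprocals are summable, and
`F z = C · (z + β₀)/(z + α₀) · ∏ (1 + z/βν)/(1 + z/αν)`. -/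
def FormIIEq (F : ℂ → ℂ) (C β₀ α₀ : ℝ) (N : ℕ∞) (β α : ℕ → ℝ) : Prop :=
  0 ≤ C ∧ 0 ≤ β₀ ∧ β₀ < α₀ ∧
  (0 < N → α₀ < β 0) ∧
  (∀ ν : ℕ, (ν : ℕ∞) < N → β ν < α ν) ∧
  (∀ ν : ℕ, ((ν : ℕ∞) + 1) < N → α ν < β (ν + 1)) ∧
  Summable (fun ν : Idx N => (α ν.1)⁻¹ + (β ν.1)⁻¹) ∧
  ∀ z ∈ SDom,
    Multipliable (fun ν : Idx N => (1 + z / (β ν.1 : ℂ)) / (1 + z / (α ν.1 : ℂ))) ∧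
    F z = (C : ℂ) * (z + (β₀ : ℂ)) / (z + (α₀ : ℂ)) *
      ∏' ν : Idx N, (1 + z / (β ν.1 : ℂ)) / (1 + z / (α ν.1 : ℂ))

/-- `F` is of Form (II). -/
def IsFormII (F : ℂ → ℂ) : Prop :=
  ∃ C β₀ α₀ N β α, FormIIEq F C β₀ α₀ N β α

open scoped ComplexConjugate

/-! ### Holomorphy of the products -/

lemma sDom_eq_slitPlane : SDom = slitPlane := by
  ext z
  simp only [SDom, Set.mem_ofPred_eq, mem_slitPlane_iff]
  rw [not_and_or, not_le, or_comm]

lemma isOpen_sDom : IsOpen SDom := sDom_eq_slitPlane ▸ isOpen_slitPlane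

lemma ne_zero_of_mem_sDom {z : ℂ} (hz : z ∈ SDom) : z ≠ 0 := by
  rintro rfl
  exact hz ⟨rfl, le_rfl⟩

lemma inv_mem_sDom {z : ℂ} (hz : z ∈ SDom) : z⁻¹ ∈ SDom := by
  have h0 : 0 < normSq z := normSq_pos.2 (ne_zero_of_mem_sDom hz)
  rintro ⟨him, hre⟩
  rw [inv_im, div_eq_zero_iff, neg_eq_zero] at him
  rw [inv_re] at hre
  refine hz ⟨him.resolve_right h0.ne', ?_⟩
  by_contra! h
  exact (div_pos h h0).not_ge hre

lemma max_abs_im_re_pos {z : ℂ} (hz : z ∈ SDom) : 0 < max |z.im| z.re := by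
  by_contra! h
  rw [max_le_iff] at h
  exact hz ⟨abs_eq_zero.1 (le_antisymm h.1 (abs_nonneg _)), h.2⟩

/-- A lower bound for `‖1 + z * t‖`, `t ≥ 0`, which is uniform in `t`. -/
lemma max_abs_im_re_le {z : ℂ} {t : ℝ} (ht : 0 ≤ t) :
    max |z.im| z.re ≤ ‖1 + z * t‖ * ‖z‖ := by
  have hprod : ‖1 + z * t‖ * ‖z‖ = ‖conj z + (normSq z * t : ℝ)‖ := by
    rw [← norm_conj z, ← norm_mul]
    congr 1
    push_cast
    rw [normSq_eq_conj_mul_self]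
    ring
  refine max_le ?_ ?_
  · rw [hprod]
    simpa using abs_im_le_norm (conj z + (normSq z * t : ℝ))
  · rw [hprod]
    have h := (le_abs_self _).trans (abs_re_le_norm (conj z + (normSq z * t : ℝ)))
    simp only [add_re, conj_re, ofReal_re] at h
    have := mul_nonneg (normSq_nonneg z) ht
    linarith

lemma one_add_div_ne_zero {z : ℂ} (hz : z ∈ SDom) {a : ℝ} (ha : 0 < a) :
    1 + z / (a : ℂ) ≠ 0 := by
  intro h
  have := max_abs_im_re_le (z := z) (inv_nonneg.2 ha.le)
  rw [ofReal_inv, ← div_eq_mul_inv, h, norm_zero, zero_mul] at this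
  exact (max_abs_im_re_pos hz).not_ge this

/-- The product `∏ (1 + z / bᵢ) / (1 + z / aᵢ)` is holomorphic on the slit plane. -/
lemma differentiableOn_tprod {ι : Type*} {a b : ι → ℝ} (ha : ∀ i, 0 < a i) (hb : ∀ i, 0 < b i)
    (hs : Summable fun i => (a i)⁻¹ + (b i)⁻¹) :
    DifferentiableOn ℂ
      (fun z => ∏' i, (1 + z / (b i : ℂ)) / (1 + z / (a i : ℂ))) SDom := by
  have hdiff (i : ι) :
      DifferentiableOn ℂ (fun z : ℂ => (1 + z / (b i : ℂ)) / (1 + z / (a i : ℂ))) SDom :=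
    DifferentiableOn.div (by fun_prop) (by fun_prop) fun z hz => one_add_div_ne_zero hz (ha i)
  set f : ι → ℂ → ℂ := fun i z => (1 + z / (b i : ℂ)) / (1 + z / (a i : ℂ)) - 1 with hf
  have hprod : HasProdLocallyUniformlyOn
      (fun i z => (1 + z / (b i : ℂ)) / (1 + z / (a i : ℂ)))
      (fun z => ∏' i, (1 + z / (b i : ℂ)) / (1 + z / (a i : ℂ))) SDom := by
    apply hasProdLocallyUniformlyOn_of_forall_compact isOpen_sDom
    intro K hK hKc
    have hcont : ContinuousOn (fun z : ℂ => ‖z‖ ^ 2 / max |z.im| z.re) K :=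
      ContinuousOn.div (by fun_prop) (by fun_prop) fun z hz => (max_abs_im_re_pos (hK hz)).ne'
    obtain ⟨M, hM⟩ := hKc.bddAbove_image hcont
    have key : HasProdUniformlyOn (fun i z => 1 + f i z) (fun z => ∏' i, (1 + f i z)) K := by
      refine Summable.hasProdUniformlyOn_one_add hKc (hs.mul_left M) (.of_forall fun i z hz => ?_)
        fun i => ((hdiff i).continuousOn.mono hK).sub continuousOn_const
      have hd := one_add_div_ne_zero (hK hz) (ha i)
      have hpos := max_abs_im_re_pos (hK hz)
      have hlow := max_abs_im_re_le (z := z) (inv_nonneg.2 (ha i).le)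
      rw [ofReal_inv, ← div_eq_mul_inv] at hlow
      have hMz : ‖z‖ ^ 2 / max |z.im| z.re ≤ M := hM ⟨z, hz, rfl⟩
      have hia := inv_pos.2 (ha i)
      have hib := inv_pos.2 (hb i)
      have hfe : f i z = z * (((b i)⁻¹ - (a i)⁻¹ : ℝ) : ℂ) / (1 + z / (a i : ℂ)) := by
        rw [hf]
        field_simp
        push_cast
        ring
      have hab : |(b i)⁻¹ - (a i)⁻¹| ≤ (a i)⁻¹ + (b i)⁻¹ :=
        abs_le.2 ⟨by linarith, by linarith⟩
      have hnorm : ‖z‖ / ‖1 + z / (a i : ℂ)‖ ≤ ‖z‖ ^ 2 / max |z.im| z.re := by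
        rw [div_le_div_iff₀ (norm_pos_iff.2 hd) hpos]
        nlinarith [norm_nonneg z]
      calc ‖f i z‖ = ‖z‖ / ‖1 + z / (a i : ℂ)‖ * |(b i)⁻¹ - (a i)⁻¹| := by
            rw [hfe, norm_div, norm_mul, norm_real, Real.norm_eq_abs]
            ring
        _ ≤ M * ((a i)⁻¹ + (b i)⁻¹) :=
            mul_le_mul (hnorm.trans hMz) hab (abs_nonneg _)
              ((div_nonneg (norm_nonneg _) (norm_nonneg _)).trans (hnorm.trans hMz))
    simpa [hf] using key
  refine TendstoLocallyUniformlyOn.differentiableOn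
    (hasProdLocallyUniformlyOn_iff_tendstoLocallyUniformlyOn.1 hprod)
    (.of_forall fun S => ?_) isOpen_sDom
  exact DifferentiableOn.fun_finsetProd fun i _ => hdiff i

/-! ### Arguments of the factors -/

/-- `s` is an argument of `w`, where every `s` is an argument of `0`. -/
def HasArg (w : ℂ) (s : ℝ) : Prop := ∃ r : ℝ, 0 ≤ r ∧ w = r * exp (s * I)

lemma HasArg.mul {w w' : ℂ} {s s' : ℝ} (h : HasArg w s) (h' : HasArg w' s') :
    HasArg (w * w') (s + s') := by
  obtain ⟨r, hr, rfl⟩ := h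
  obtain ⟨r', hr', rfl⟩ := h'
  refine ⟨r * r', mul_nonneg hr hr', ?_⟩
  push_cast
  rw [add_mul, exp_add]
  ring

lemma HasArg.inv {w : ℂ} {s : ℝ} (h : HasArg w s) : HasArg w⁻¹ (-s) := by
  obtain ⟨r, hr, rfl⟩ := h
  refine ⟨r⁻¹, inv_nonneg.2 hr, ?_⟩
  push_cast
  rw [neg_mul, exp_neg, mul_inv]

lemma HasArg.div {w w' : ℂ} {s s' : ℝ} (h : HasArg w s) (h' : HasArg w' s') :
    HasArg (w / w') (s - s') := by
  simpa [div_eq_mul_inv, sub_eq_add_neg] using h.mul h'.inv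

lemma hasArg_ofReal {r : ℝ} (hr : 0 ≤ r) : HasArg r 0 := ⟨r, hr, by simp⟩

lemma hasArg_prod {ι : Type*} (S : Finset ι) {w : ι → ℂ} {s : ι → ℝ}
    (h : ∀ i, HasArg (w i) (s i)) : HasArg (∏ i ∈ S, w i) (∑ i ∈ S, s i) := by
  classical
  induction S using Finset.induction_on with
  | empty => simpa using hasArg_ofReal zero_le_one
  | insert i S hi ih =>
    rw [Finset.prod_insert hi, Finset.sum_insert hi]
    exact (h i).mul ih

lemma HasArg.im_mul_conj_nonneg {z w : ℂ} {t s : ℝ} (hz : HasArg z t) (hw : HasArg w s)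
    (h0 : 0 ≤ t - s) (hpi : t - s ≤ Real.pi) : 0 ≤ (z * conj w).im := by
  obtain ⟨r, hr, rfl⟩ := hz
  obtain ⟨q, hq, rfl⟩ := hw
  have : (r : ℂ) * exp (t * I) * conj ((q : ℂ) * exp (s * I))
      = ((r * q : ℝ) : ℂ) * exp ((t - s : ℝ) * I) := by
    rw [map_mul, ← exp_conj, map_mul, conj_ofReal, conj_ofReal, conj_I]
    push_cast
    rw [sub_mul, sub_eq_add_neg, exp_add, mul_neg]
    ring
  rw [this, im_ofReal_mul, exp_ofReal_mul_I_im]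
  exact mul_nonneg (mul_nonneg hr hq) (Real.sin_nonneg_of_nonneg_of_le_pi h0 hpi)

/-- For `Im z > 0`, the argument in `(0, π)` of `z + x`. -/
noncomputable def shiftArg (z : ℂ) (x : ℝ) : ℝ :=
  Real.pi / 2 - Real.arctan ((z.re + x) / z.im)

lemma hasArg_add {z : ℂ} (hz : 0 < z.im) (x : ℝ) : HasArg (z + x) (shiftArg z x) := by
  set t : ℝ := (z.re + x) / z.im with ht
  have hs : 0 < √(1 + t ^ 2) := Real.sqrt_pos.2 (by positivity)
  refine ⟨z.im * √(1 + t ^ 2), by positivity, ?_⟩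
  have harg : shiftArg z x = Real.pi / 2 - Real.arctan t := rfl
  apply Complex.ext
  · rw [re_ofReal_mul, exp_ofReal_mul_I_re, harg, Real.cos_pi_div_two_sub, Real.sin_arctan]
    rw [add_re, ofReal_re, mul_assoc, mul_div_cancel₀ _ hs.ne', ht, mul_div_cancel₀ _ hz.ne']
  · rw [im_ofReal_mul, exp_ofReal_mul_I_im, harg, Real.sin_pi_div_two_sub, Real.cos_arctan]
    rw [add_im, ofReal_im, add_zero, mul_assoc, mul_div_cancel₀ _ hs.ne', mul_one]

lemma shiftArg_anti {z : ℂ} (hz : 0 < z.im) : Antitone (shiftArg z) := fun x y h => by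
  unfold shiftArg
  have : (z.re + x) / z.im ≤ (z.re + y) / z.im := by gcongr
  have := Real.arctan_mono this
  linarith

lemma shiftArg_nonneg (z : ℂ) (x : ℝ) : 0 ≤ shiftArg z x := by
  unfold shiftArg
  linarith [Real.arctan_lt_pi_div_two ((z.re + x) / z.im)]

lemma shiftArg_le_pi (z : ℂ) (x : ℝ) : shiftArg z x ≤ Real.pi := by
  unfold shiftArg
  linarith [Real.neg_pi_div_two_lt_arctan ((z.re + x) / z.im)]

lemma hasArg_self {z : ℂ} (hz : 0 < z.im) : HasArg z (shiftArg z 0) := by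
  simpa using hasArg_add hz 0

lemma hasArg_factor {z : ℂ} (hz : 0 < z.im) {a b : ℝ} (ha : 0 < a) (hb : 0 < b) :
    HasArg ((1 + z / (b : ℂ)) / (1 + z / (a : ℂ))) (shiftArg z b - shiftArg z a) := by
  have ha' : (a : ℂ) ≠ 0 := ofReal_ne_zero.2 ha.ne'
  have hb' : (b : ℂ) ≠ 0 := ofReal_ne_zero.2 hb.ne'
  have heq : (1 + z / (b : ℂ)) / (1 + z / (a : ℂ))
      = ((a / b : ℝ) : ℂ) * ((z + b) / (z + a)) := by
    rw [one_add_div hb', one_add_div ha', div_div_div_eq, add_comm (b : ℂ), add_comm (a : ℂ),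
      ofReal_div, div_mul_div_comm]
    congr 1
    ring
  rw [heq]
  simpa using (hasArg_ofReal (div_pos ha hb).le).mul ((hasArg_add hz b).div (hasArg_add hz a))

lemma hasArg_inv_factor {z : ℂ} (hz : 0 < z.im) (a b : ℝ) :
    HasArg ((1 + z⁻¹ / (b : ℂ)) / (1 + z⁻¹ / (a : ℂ)))
      (shiftArg z b⁻¹ - shiftArg z a⁻¹) := by
  have hz0 : z ≠ 0 := by
    rintro rfl
    simp at hz
  have hone (c : ℝ) : 1 + z⁻¹ / (c : ℂ) = (z + (c⁻¹ : ℝ)) / z := by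
    rw [add_div, div_self hz0, ofReal_inv, div_eq_mul_inv, div_eq_mul_inv, mul_comm]
  rw [hone, hone, div_div_div_cancel_right₀ hz0]
  exact (hasArg_add hz _).div (hasArg_add hz _)

/-! ### Interlacing sums -/

/-- A sum of lengths of the disjoint intervals `[v ν, u ν]`, arranged in decreasing order, is at
most the length of any interval containing them. -/
lemma sum_interlacing_le {N : ℕ∞} {u v : ℕ → ℝ} {B : ℝ}
    (huv : ∀ ν : ℕ, (ν : ℕ∞) < N → v ν ≤ u ν)
    (hstep : ∀ ν : ℕ, ((ν : ℕ∞) + 1) < N → u (ν + 1) ≤ v ν)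
    (hB : 0 ≤ B) (huB : ∀ ν : ℕ, (ν : ℕ∞) < N → u 0 - v ν ≤ B) (S : Finset (Idx N)) :
    ∑ ν ∈ S, (u ν.1 - v ν.1) ≤ B := by
  have hrange : ∀ n : ℕ, (n : ℕ∞) < N → ∑ ν ∈ Finset.range (n + 1), (u ν - v ν) ≤ u 0 - v n := by
    intro n
    induction n with
    | zero => intro _; simp
    | succ n ih =>
      intro hn
      rw [Nat.cast_add, Nat.cast_one] at hn
      rw [Finset.sum_range_succ]
      have h1 := ih (lt_of_le_of_lt le_self_add hn)
      have h2 := hstep n hn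
      linarith
  rcases S.eq_empty_or_nonempty with rfl | hS
  · simpa using hB
  obtain ⟨m, -, hm⟩ := S.exists_max_image (fun ν => ν.1) hS
  calc ∑ ν ∈ S, (u ν.1 - v ν.1)
      = ∑ ν ∈ S.map ⟨fun ν : Idx N => ν.1, Subtype.val_injective⟩, (u ν - v ν) :=
        (Finset.sum_map S ⟨fun ν : Idx N => ν.1, Subtype.val_injective⟩ fun ν => u ν - v ν).symm
    _ ≤ ∑ ν ∈ Finset.range (m.1 + 1), (u ν - v ν) := by
        refine Finset.sum_le_sum_of_subset_of_nonneg ?_ fun ν hν _ => ?_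
        · intro ν hν
          obtain ⟨μ, hμ, rfl⟩ := Finset.mem_map.1 hν
          exact Finset.mem_range.2 (Nat.lt_succ_of_le (hm μ hμ))
        · refine sub_nonneg.2 (huv ν (lt_of_le_of_lt ?_ m.2))
          exact_mod_cast Nat.lt_succ_iff.1 (Finset.mem_range.1 hν)
    _ ≤ u 0 - v m.1 := hrange m.1 m.2
    _ ≤ B := huB m.1 m.2

/-! ### The quotient -/

lemma im_mul_conj_nonneg_of_conj_symm {W : ℂ → ℂ} (hW : ∀ z, W (conj z) = conj (W z))
    (h : ∀ z, 0 < z.im → 0 ≤ (z * conj (W z)).im) (z : ℂ) :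
    0 ≤ z.im * (z * conj (W z)).im := by
  rcases lt_trichotomy z.im 0 with hz | hz | hz
  · have h1 := h (conj z) (by simpa using hz)
    rw [hW, ← map_mul, conj_im] at h1
    exact mul_nonneg_of_nonpos_of_nonpos hz.le (by linarith)
  · simp [hz]
  · exact mul_nonneg hz.le (h z hz)

lemma isClosed_im_mul_conj (z : ℂ) : IsClosed {w : ℂ | 0 ≤ z.im * (z * conj w).im} :=
  isClosed_le continuous_const (by fun_prop)

/-- `z / F z` is an `S`-function off the zeros of `F` as soon as `F` is holomorphic on the slit
plane, nonnegative on the positive half-line, and its argument lies between `0` and `arg z`. -/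
lemma div_sFun {F : ℂ → ℂ} (hF : DifferentiableOn ℂ F SDom)
    (him : ∀ z ∈ SDom, 0 ≤ z.im * (z * conj (F z)).im)
    (hpos : ∀ x : ℝ, 0 < x → ∃ y : ℝ, 0 ≤ y ∧ F x = y) :
    DifferentiableOn ℂ (fun z => z / F z) {z | z ∈ SDom ∧ F z ≠ 0} ∧
    (∀ z ∈ SDom, F z ≠ 0 → 0 ≤ z.im * (z / F z).im) ∧
    (∀ x : ℝ, 0 < x → ((x : ℂ) / F (x : ℂ)).im = 0 ∧ 0 ≤ ((x : ℂ) / F (x : ℂ)).re) := by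
  refine ⟨differentiableOn_id.div (hF.mono fun z hz => hz.1) fun z hz => hz.2, ?_, ?_⟩
  · intro z hz _
    rw [div_eq_mul_inv, inv_def, ← mul_assoc, im_mul_ofReal, ← mul_assoc]
    exact mul_nonneg (him z hz) (inv_nonneg.2 (normSq_nonneg _))
  · intro x hx
    obtain ⟨y, hy, hFy⟩ := hpos x hx
    rw [hFy, ← ofReal_div]
    exact ⟨ofReal_im _, by simpa using div_nonneg hx.le hy⟩

open scoped ComplexOrder in
lemma exists_ofReal_of_nonneg {w : ℂ} (hw : 0 ≤ w) : ∃ y : ℝ, 0 ≤ y ∧ w = y :=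
  ⟨w.re, (nonneg_iff.1 hw).1, Complex.ext rfl (nonneg_iff.1 hw).2.symm⟩

open scoped ComplexOrder in
lemma tprod_factor_nonneg {ι : Type*} {a b : ι → ℝ} (ha : ∀ i, 0 < a i) (hb : ∀ i, 0 < b i)
    {x : ℝ} (hx : 0 < x) :
    0 ≤ ∏' i, (1 + (x : ℂ) / (b i : ℂ)) / (1 + (x : ℂ) / (a i : ℂ)) := by
  refine tprod_nonneg fun i => ?_
  have := ha i
  have := hb i
  exact_mod_cast (by positivity : (0 : ℝ) ≤ (1 + x / b i) / (1 + x / a i))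

section FormI

variable {F : ℂ → ℂ} {C : ℝ} {Np Nm : ℕ∞} {αp βp αm βm : ℕ → ℝ}

lemma FormIEq.differentiableOn (h : FormIEq F C Np Nm αp βp αm βm) :
    DifferentiableOn ℂ F SDom := by
  obtain ⟨_, hp, _, hm, _, _, hsp, hsm, hF⟩ := h
  have hP := differentiableOn_tprod (a := fun ν : Idx Np => αp ν.1) (b := fun ν => βp ν.1)
    (fun ν => (hp _ ν.2).1.trans (hp _ ν.2).2) (fun ν => (hp _ ν.2).1) hsp
  have hM := (differentiableOn_tprod (a := fun ν : Idx Nm => αm ν.1) (b := fun ν => βm ν.1)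
    (fun ν => (hm _ ν.2).2.1) (fun ν => (hm _ ν.2).1) hsm).comp
    (differentiableOn_inv.mono fun z hz => ne_zero_of_mem_sDom hz) fun z hz => inv_mem_sDom hz
  exact ((hP.const_mul (C : ℂ)).mul hM).congr fun z hz => (hF z hz).2.2

open scoped ComplexOrder in
lemma FormIEq.nonneg (h : FormIEq F C Np Nm αp βp αm βm) {x : ℝ} (hx : 0 < x) : 0 ≤ F x := by
  obtain ⟨hC, hp, _, hm, _, _, _, _, hF⟩ := h
  rw [(hF x fun h => h.2.not_gt hx).2.2, ← ofReal_inv]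
  refine mul_nonneg (mul_nonneg (by exact_mod_cast hC.le) ?_) ?_
  · exact tprod_factor_nonneg (a := fun ν : Idx Np => αp ν.1) (b := fun ν => βp ν.1)
      (fun ν => (hp _ ν.2).1.trans (hp _ ν.2).2) (fun ν => (hp _ ν.2).1) hx
  · exact tprod_factor_nonneg (a := fun ν : Idx Nm => αm ν.1) (b := fun ν => βm ν.1)
      (fun ν => (hm _ ν.2).2.1) (fun ν => (hm _ ν.2).1) (inv_pos.2 hx)

lemma FormIEq.im_mul_conj_finite_nonneg (h : FormIEq F C Np Nm αp βp αm βm)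
    (S : Finset (Idx Np)) (T : Finset (Idx Nm)) {z : ℂ} (hz : 0 < z.im) :
    0 ≤ (z * conj ((C : ℂ) * (∏ ν ∈ S, (1 + z / (βp ν.1 : ℂ)) / (1 + z / (αp ν.1 : ℂ))) *
      ∏ ν ∈ T, (1 + z⁻¹ / (βm ν.1 : ℂ)) / (1 + z⁻¹ / (αm ν.1 : ℂ)))).im := by
  obtain ⟨hC, hp, hpstep, hm, hmstep, hpm, _⟩ := h
  have hanti := shiftArg_anti hz
  obtain ⟨c, hc0, hcp, hcm⟩ : ∃ c : ℝ, 0 ≤ c ∧ (0 < Np → c ≤ βp 0) ∧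
      (0 < Nm → (αm 0)⁻¹ ≤ c) := by
    by_cases hm0 : 0 < Nm
    · exact ⟨(αm 0)⁻¹, inv_nonneg.2 (hm 0 (by simpa using hm0)).2.1.le,
        fun hp0 => (hpm hp0 hm0).le, fun _ => le_rfl⟩
    · exact ⟨0, le_rfl, fun hp0 => (hp 0 (by simpa using hp0)).1.le, fun h => absurd h hm0⟩
  have hP := hasArg_prod S fun ν : Idx Np =>
    hasArg_factor hz ((hp _ ν.2).1.trans (hp _ ν.2).2) (hp _ ν.2).1
  have hM := hasArg_prod T fun ν : Idx Nm => hasArg_inv_factor hz (αm ν.1) (βm ν.1)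
  have hP0 : 0 ≤ ∑ ν ∈ S, (shiftArg z (βp ν.1) - shiftArg z (αp ν.1)) :=
    Finset.sum_nonneg fun ν _ => sub_nonneg.2 (hanti (hp _ ν.2).2.le)
  have hM0 : 0 ≤ ∑ ν ∈ T, (shiftArg z (βm ν.1)⁻¹ - shiftArg z (αm ν.1)⁻¹) :=
    Finset.sum_nonneg fun ν _ => sub_nonneg.2 (hanti (hm _ ν.2).2.2.le)
  have hP1 : ∑ ν ∈ S, (shiftArg z (βp ν.1) - shiftArg z (αp ν.1)) ≤ shiftArg z c := by
    refine sum_interlacing_le (u := fun ν => shiftArg z (βp ν))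
      (v := fun ν => shiftArg z (αp ν)) (fun ν hν => hanti (hp ν hν).2.le)
      (fun ν hν => hanti (hpstep ν hν).le) (shiftArg_nonneg z c) (fun ν hν => ?_) S
    have h1 := hanti (hcp (lt_of_le_of_lt zero_le hν))
    have h2 := shiftArg_nonneg z (αp ν)
    linarith
  have hM1 : ∑ ν ∈ T, (shiftArg z (βm ν.1)⁻¹ - shiftArg z (αm ν.1)⁻¹)
      ≤ shiftArg z 0 - shiftArg z c := by
    have := sum_interlacing_le (u := fun ν => -shiftArg z (αm ν)⁻¹)
      (v := fun ν => -shiftArg z (βm ν)⁻¹) (B := shiftArg z 0 - shiftArg z c)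
      (fun ν hν => neg_le_neg (hanti (hm ν hν).2.2.le))
      (fun ν hν => neg_le_neg (hanti (hmstep ν hν).le)) (sub_nonneg.2 (hanti hc0))
      (fun ν hν => ?_) T
    · simpa only [neg_sub_neg] using this
    have h1 := hanti (hcm (lt_of_le_of_lt zero_le hν))
    have h2 := hanti (inv_nonneg.2 (hm ν hν).1.le)
    linarith
  have hpi := shiftArg_le_pi z 0
  refine (hasArg_self hz).im_mul_conj_nonneg (((hasArg_ofReal hC.le).mul hP).mul hM) ?_ ?_ <;>
    linarith

lemma FormIEq.im_mul_conj_nonneg (h : FormIEq F C Np Nm αp βp αm βm) {z : ℂ} (hz : z ∈ SDom) :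
    0 ≤ z.im * (z * conj (F z)).im := by
  obtain ⟨hmp, hmm, hF⟩ := h.2.2.2.2.2.2.2.2 z hz
  rw [hF]
  refine (isClosed_im_mul_conj z).mem_of_tendsto
    (tendsto_const_nhds.mul hmm.hasProd) (.of_forall fun T => ?_)
  refine (isClosed_im_mul_conj z).mem_of_tendsto
    ((tendsto_const_nhds.mul hmp.hasProd).mul_const _) (.of_forall fun S => ?_)
  refine im_mul_conj_nonneg_of_conj_symm
    (W := fun z => (C : ℂ) * (∏ ν ∈ S, (1 + z / (βp ν.1 : ℂ)) / (1 + z / (αp ν.1 : ℂ))) *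
      ∏ ν ∈ T, (1 + z⁻¹ / (βm ν.1 : ℂ)) / (1 + z⁻¹ / (αm ν.1 : ℂ))) (fun z => ?_)
    (fun z hz => h.im_mul_conj_finite_nonneg S T hz) z
  simp [map_prod]

end FormI

section FormII

variable {F : ℂ → ℂ} {C β₀ α₀ : ℝ} {N : ℕ∞} {β α : ℕ → ℝ}

lemma FormIIEq.pos (h : FormIIEq F C β₀ α₀ N β α) {ν : ℕ} (hν : (ν : ℕ∞) < N) :
    0 < β ν ∧ 0 < α ν := by
  obtain ⟨_, hβ₀, hβα₀, hα₀, hβα, hαβ, _⟩ := h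
  have hβ : 0 < β ν := by
    induction ν with
    | zero => exact (hβ₀.trans_lt hβα₀).trans (hα₀ (by simpa using hν))
    | succ n ih =>
      rw [Nat.cast_add, Nat.cast_one] at hν
      have hn := lt_of_le_of_lt le_self_add hν
      exact ((ih hn).trans (hβα n hn)).trans (hαβ n hν)
  exact ⟨hβ, hβ.trans (hβα ν hν)⟩

lemma FormIIEq.differentiableOn (h : FormIIEq F C β₀ α₀ N β α) : DifferentiableOn ℂ F SDom := by
  have hpos {ν : ℕ} (hν : (ν : ℕ∞) < N) := h.pos hν
  obtain ⟨_, hβ₀, hβα₀, _, _, _, hs, hF⟩ := h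
  have hα₀ : 0 < α₀ := hβ₀.trans_lt hβα₀
  have hP := differentiableOn_tprod (a := fun ν : Idx N => α ν.1) (b := fun ν => β ν.1)
    (fun ν => (hpos ν.2).2) (fun ν => (hpos ν.2).1) hs
  have h0 : DifferentiableOn ℂ (fun z : ℂ => (C : ℂ) * (z + (β₀ : ℂ)) / (z + (α₀ : ℂ))) SDom := by
    refine DifferentiableOn.div (by fun_prop) (by fun_prop) fun z hz h => ?_
    rw [add_eq_zero_iff_eq_neg, ← ofReal_neg] at h
    subst h
    exact hz ⟨ofReal_im _, by simpa using hα₀.le⟩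
  exact (h0.mul hP).congr fun z hz => (hF z hz).2

open scoped ComplexOrder in
lemma FormIIEq.nonneg (h : FormIIEq F C β₀ α₀ N β α) {x : ℝ} (hx : 0 < x) : 0 ≤ F x := by
  have hpos {ν : ℕ} (hν : (ν : ℕ∞) < N) := h.pos hν
  obtain ⟨hC, hβ₀, hβα₀, _, _, _, _, hF⟩ := h
  have hα₀ : 0 < α₀ := hβ₀.trans_lt hβα₀
  rw [(hF x fun h => h.2.not_gt hx).2]
  refine mul_nonneg ?_ ?_
  · exact_mod_cast (by positivity : (0 : ℝ) ≤ C * (x + β₀) / (x + α₀))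
  · exact tprod_factor_nonneg (a := fun ν : Idx N => α ν.1) (b := fun ν => β ν.1)
      (fun ν => (hpos ν.2).2) (fun ν => (hpos ν.2).1) hx

lemma FormIIEq.im_mul_conj_finite_nonneg (h : FormIIEq F C β₀ α₀ N β α) (S : Finset (Idx N))
    {z : ℂ} (hz : 0 < z.im) :
    0 ≤ (z * conj ((C : ℂ) * (z + (β₀ : ℂ)) / (z + (α₀ : ℂ)) *
      ∏ ν ∈ S, (1 + z / (β ν.1 : ℂ)) / (1 + z / (α ν.1 : ℂ)))).im := by
  have hpos {ν : ℕ} (hν : (ν : ℕ∞) < N) := h.pos hν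
  obtain ⟨hC, hβ₀, hβα₀, hα₀, hβα, hαβ, _⟩ := h
  have hanti := shiftArg_anti hz
  have hP := hasArg_prod S fun ν : Idx N => hasArg_factor hz (hpos ν.2).2 (hpos ν.2).1
  have hP0 : 0 ≤ ∑ ν ∈ S, (shiftArg z (β ν.1) - shiftArg z (α ν.1)) :=
    Finset.sum_nonneg fun ν _ => sub_nonneg.2 (hanti (hβα _ ν.2).le)
  have hP1 : ∑ ν ∈ S, (shiftArg z (β ν.1) - shiftArg z (α ν.1)) ≤ shiftArg z α₀ := by
    refine sum_interlacing_le (u := fun ν => shiftArg z (β ν))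
      (v := fun ν => shiftArg z (α ν)) (fun ν hν => hanti (hβα ν hν).le)
      (fun ν hν => hanti (hαβ ν hν).le) (shiftArg_nonneg z α₀) (fun ν hν => ?_) S
    have h1 := hanti (hα₀ (lt_of_le_of_lt zero_le hν)).le
    have h2 := shiftArg_nonneg z (α ν)
    linarith
  have h0 := hanti hβ₀
  have h1 := hanti hβα₀.le
  have hpi := shiftArg_le_pi z 0
  refine (hasArg_self hz).im_mul_conj_nonneg ((((hasArg_ofReal hC).mul
    (hasArg_add hz β₀)).div (hasArg_add hz α₀)).mul hP) ?_ ?_ <;>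
    linarith

lemma FormIIEq.im_mul_conj_nonneg (h : FormIIEq F C β₀ α₀ N β α) {z : ℂ} (hz : z ∈ SDom) :
    0 ≤ z.im * (z * conj (F z)).im := by
  obtain ⟨hm, hF⟩ := h.2.2.2.2.2.2.2 z hz
  rw [hF]
  refine (isClosed_im_mul_conj z).mem_of_tendsto
    (tendsto_const_nhds.mul hm.hasProd) (.of_forall fun S => ?_)
  refine im_mul_conj_nonneg_of_conj_symm
    (W := fun z => (C : ℂ) * (z + (β₀ : ℂ)) / (z + (α₀ : ℂ)) *
      ∏ ν ∈ S, (1 + z / (β ν.1 : ℂ)) / (1 + z / (α ν.1 : ℂ))) (fun z => ?_)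
    (fun z hz => h.im_mul_conj_finite_nonneg S hz) z
  simp [map_prod]

end FormII

theorem stmt14 (F : ℂ → ℂ)
    (h : IsFormI F ∨ (∃ C β₀ α₀ N β α, FormIIEq F C β₀ α₀ N β α ∧ 0 < C)) :
    DifferentiableOn ℂ (fun z => z / F z) {z | z ∈ SDom ∧ F z ≠ 0} ∧
    (∀ z ∈ SDom, F z ≠ 0 → 0 ≤ z.im * (z / F z).im) ∧
    (∀ x : ℝ, 0 < x → ((x : ℂ) / F (x : ℂ)).im = 0 ∧ 0 ≤ ((x : ℂ) / F (x : ℂ)).re) := by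
  rcases h with ⟨C, Np, Nm, αp, βp, αm, βm, h⟩ | ⟨C, β₀, α₀, N, β, α, h, -⟩
  · exact div_sFun h.differentiableOn (fun z hz => h.im_mul_conj_nonneg hz)
      fun x hx => exists_ofReal_of_nonneg (h.nonneg hx)
  · exact div_sFun h.differentiableOn (fun z hz => h.im_mul_conj_nonneg hz)
      fun x hx => exists_ofReal_of_nonneg (h.nonneg hx)
end
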